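/- Let π be a unitary representation of a countable group G on a separable complex Hilbert space H having no nonzero finite-dimensional closed π(G)-invariant subspace. If ν is a Borel probability measure on the closed unit ball B₁(H) (with the weak topology) that is invariant under x ↦ π(g)x for every g ∈ G, then ν is the Dirac measure at 0; equivalently, ∫_{B₁(H)} |⟨y, x⟩|² dν(x) = 0 for every y ∈ H. -/

import Mathlib

open Filter MeasureTheory
open scoped Classical InnerProductSpace

/-- A probability measure on a countable group, given as a weight function. -/
def IsProbMeasure {G : Type*} [Group G] (μ : G → ℝ) : Prop :=
  (∀ g, 0 ≤ μ g) ∧ HasSum μ 1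

/-- The support of `μ` generates `G` as a semigroup. -/
def SuppGenerates {G : Type*} [Group G] (μ : G → ℝ) : Prop :=
  Subsemigroup.closure {g | 0 < μ g} = ⊤

noncomputable section

variable (H : Type*) [NormedAddCommGroup H] [InnerProductSpace ℂ H]

/-- The closed unit ball of `H`, considered with the weak topology. -/
def WeakUnitBall : Type _ := {x : H // ‖x‖ ≤ 1}

instance : TopologicalSpace (WeakUnitBall H) :=
  TopologicalSpace.induced (fun x : WeakUnitBall H => toWeakSpace ℂ H x.1) inferInstance

instance : MeasurableSpace (WeakUnitBall H) := borel _

instance : BorelSpace (WeakUnitBall H) := ⟨rfl⟩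

/-- The origin, as an element of the closed unit ball. -/
def zeroBall : WeakUnitBall H := ⟨0, by simp⟩

variable {H} in
/-- The action of a unitary operator on the closed unit ball. -/
def ballMap (T : H ≃ₗᵢ[ℂ] H) : WeakUnitBall H → WeakUnitBall H :=
  fun x => ⟨T x.1, by rw [T.norm_map]; exact x.2⟩

end

namespace WeakUnitBall

variable {H : Type*} [NormedAddCommGroup H] [InnerProductSpace ℂ H]

/-- Norm-closed convex sets are closed in the weak topology of the unit ball. -/
lemma isClosed_preimage_of_convex {s : Set H} (hs : Convex ℝ s) (hc : IsClosed s) :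
    IsClosed {x : WeakUnitBall H | x.1 ∈ s} := by
  have h : IsClosed (toWeakSpace ℂ H '' s) := by
    rw [← closure_eq_iff_isClosed, ← hs.toWeakSpace_closure ℂ, hc.closure_eq]
  have hcont : Continuous fun x : WeakUnitBall H => toWeakSpace ℂ H x.1 :=
    continuous_induced_dom
  convert h.preimage hcont using 1
  ext x
  simp

/-- The inclusion of the weak unit ball of a separable space is Borel for the norm topology. -/
lemma measurable_coe [TopologicalSpace.SeparableSpace H] [MeasurableSpace H] [BorelSpace H] :
    Measurable fun x : WeakUnitBall H => x.1 := by
  have : SecondCountableTopology H := UniformSpace.secondCountable_of_separable H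
  refine measurable_of_isOpen fun U hU => ?_
  have hball : ∀ a : H, ∃ r : ℝ, a ∈ U → 0 < r ∧ Metric.closedBall a r ⊆ U := fun a => by
    by_cases ha : a ∈ U
    · obtain ⟨r, hr, h⟩ := Metric.nhds_basis_closedBall.mem_iff.1 (hU.mem_nhds ha)
      exact ⟨r, fun _ => ⟨hr, h⟩⟩
    · exact ⟨0, fun h => absurd h ha⟩
  choose r hr using hball
  obtain ⟨t, htU, htc, hcov⟩ := TopologicalSpace.countable_cover_nhdsWithin
    (f := fun a => Metric.closedBall a (r a)) (s := U) fun a ha =>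
      mem_nhdsWithin_of_mem_nhds (Metric.closedBall_mem_nhds a (hr a ha).1)
  have hU_eq : U = ⋃ a ∈ t, Metric.closedBall a (r a) :=
    hcov.antisymm (Set.iUnion₂_subset fun a ha => (hr a (htU ha)).2)
  rw [hU_eq, Set.preimage_iUnion₂]
  exact MeasurableSet.biUnion htc fun a _ =>
    (isClosed_preimage_of_convex (convex_closedBall a (r a)) Metric.isClosed_closedBall).measurableSet

/-- The operator-valued map sending `x` to the rank-one operator `z ↦ ⟪x, z⟫ x`. -/
noncomputable def rankOneSelf (x : WeakUnitBall H) : H →L[ℂ] H :=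
  InnerProductSpace.rankOne ℂ x.1 x.1

lemma rankOneSelf_apply (x : WeakUnitBall H) (z : H) :
    rankOneSelf x z = ⟪x.1, z⟫_ℂ • x.1 := rfl

lemma isCompactOperator_rankOneSelf (x : WeakUnitBall H) : IsCompactOperator (rankOneSelf x) := by
  have h : IsCompactOperator (innerSL ℂ x.1) :=
    isCompactOperator_of_locallyCompactSpace_dom _
  exact h.clm_comp (ContinuousLinearMap.toSpanSingleton ℂ x.1)

lemma integrable_rankOneSelf [TopologicalSpace.SeparableSpace H]
    (ν : Measure (WeakUnitBall H)) [IsFiniteMeasure ν] : Integrable rankOneSelf ν := by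
  have : SecondCountableTopology H := UniformSpace.secondCountable_of_separable H
  borelize H
  have hcont : Continuous fun x : H => InnerProductSpace.rankOne ℂ x x :=
    ((ContinuousLinearMap.smulRightL ℂ H H).continuous.comp
      (innerSL ℂ).continuous).clm_apply continuous_id
  refine Integrable.of_bound
    (hcont.stronglyMeasurable.comp_measurable measurable_coe).aestronglyMeasurable 1
    (ae_of_all _ fun x => ?_)
  rw [rankOneSelf, InnerProductSpace.norm_rankOne]
  exact mul_le_one₀ x.2 (norm_nonneg _) x.2

/-- The covariance operator `z ↦ ∫ ⟪x, z⟫ x dν(x)` of a measure on the unit ball. -/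
noncomputable def covariance (ν : Measure (WeakUnitBall H)) : H →L[ℂ] H :=
  ∫ x, rankOneSelf x ∂ν

lemma covariance_apply [TopologicalSpace.SeparableSpace H]
    (ν : Measure (WeakUnitBall H)) [IsFiniteMeasure ν] (z : H) :
    covariance ν z = ∫ x, ⟪x.1, z⟫_ℂ • x.1 ∂ν :=
  ContinuousLinearMap.integral_apply (integrable_rankOneSelf ν) z

lemma measurable_ballMap (T : H ≃ₗᵢ[ℂ] H) : Measurable (ballMap T) := by
  refine Continuous.measurable (continuous_induced_rng.2 ?_)
  exact (WeakSpace.map (T : H →L[ℂ] H)).continuous.comp continuous_induced_dom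

lemma ae_eq_zeroBall [TopologicalSpace.SeparableSpace H]
    (ν : Measure (WeakUnitBall H)) [IsFiniteMeasure ν]
    (h : ∀ y : H, ∫ x : WeakUnitBall H, ‖⟪y, x.1⟫_ℂ‖ ^ 2 ∂ν = 0) :
    ∀ᵐ x ∂ν, x = zeroBall H := by
  borelize H
  have hae : ∀ n, ∀ᵐ x : WeakUnitBall H ∂ν, ⟪TopologicalSpace.denseSeq H n, x.1⟫_ℂ = 0 := by
    intro n
    set y := TopologicalSpace.denseSeq H n
    have hint : Integrable (fun x : WeakUnitBall H => ‖⟪y, x.1⟫_ℂ‖ ^ 2) ν := by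
      refine Integrable.of_bound (C := ‖y‖ ^ 2) ?_ (ae_of_all _ fun x => ?_)
      · have : SecondCountableTopology H := UniformSpace.secondCountable_of_separable H
        have hcont : Continuous fun x : H => ‖⟪y, x⟫_ℂ‖ ^ 2 := by fun_prop
        exact (hcont.measurable.comp measurable_coe).aestronglyMeasurable
      · rw [norm_pow, norm_norm]
        gcongr
        exact (norm_inner_le_norm y x.1).trans
          (mul_le_of_le_one_right (norm_nonneg _) x.2)
    filter_upwards [(integral_eq_zero_iff_of_nonneg (fun x => by positivity) hint).1 (h y)]
      with x hx
    simpa using hx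
  filter_upwards [ae_all_iff.2 hae] with x hx
  have hx0 : x.1 = 0 :=
    (TopologicalSpace.denseRange_denseSeq H).eq_zero_of_inner_right ℂ hx
  exact Subtype.ext hx0

section Covariance

variable [CompleteSpace H] [TopologicalSpace.SeparableSpace H]
  (ν : Measure (WeakUnitBall H))

lemma inner_covariance [IsFiniteMeasure ν] (y z : H) :
    ⟪y, covariance ν z⟫_ℂ = ∫ x, ⟪x.1, z⟫_ℂ * ⟪y, x.1⟫_ℂ ∂ν := by
  rw [covariance_apply]
  refine (integral_inner ((integrable_rankOneSelf ν).apply_continuousLinearMap z) y).symm.trans ?_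
  congr 1 with x
  rw [rankOneSelf_apply, inner_smul_right]

lemma inner_covariance_self [IsFiniteMeasure ν] (y : H) :
    ⟪y, covariance ν y⟫_ℂ = (∫ x, ‖⟪y, x.1⟫_ℂ‖ ^ 2 ∂ν : ℝ) := by
  rw [inner_covariance, ← integral_complex_ofReal]
  congr 1 with x
  rw [← inner_conj_symm, RCLike.conj_mul]
  simp

lemma isSymmetric_covariance [IsFiniteMeasure ν] :
    (covariance ν : H →ₗ[ℂ] H).IsSymmetric := by
  intro y z
  change ⟪covariance ν y, z⟫_ℂ = ⟪y, covariance ν z⟫_ℂ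
  rw [← inner_conj_symm, inner_covariance, inner_covariance, ← integral_conj]
  congr 1 with x
  simp [mul_comm]

lemma isCompactOperator_covariance [IsProbabilityMeasure ν] :
    IsCompactOperator (covariance ν) :=
  Convex.integral_mem (s := {T : H →L[ℂ] H | IsCompactOperator T})
    (fun _ hS _ hT a b _ _ _ => (hS.smul a).add (hT.smul b))
    isClosed_setOfPred_isCompactOperator
    (ae_of_all _ isCompactOperator_rankOneSelf) (integrable_rankOneSelf ν)

lemma covariance_comm [IsFiniteMeasure ν] (T : H ≃ₗᵢ[ℂ] H)
    (hT : Measure.map (ballMap T) ν = ν) (z : H) :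
    covariance ν (T z) = T (covariance ν z) := by
  have hint := (integrable_rankOneSelf ν).apply_continuousLinearMap
  have hmap : covariance ν (T z) = ∫ x, rankOneSelf (ballMap T x) (T z) ∂ν := by
    rw [← integral_map (measurable_ballMap T).aemeasurable
      (f := fun x => rankOneSelf x (T z)) (by rw [hT]; exact (hint (T z)).aestronglyMeasurable), hT]
    exact covariance_apply ν (T z)
  have hcomm := ContinuousLinearMap.integral_comp_comm (T : H →L[ℂ] H) (hint z)
  rw [hmap, covariance_apply]
  refine Eq.trans ?_ hcomm
  congr 1 with x
  change ⟪T x.1, T z⟫_ℂ • T x.1 = T (⟪x.1, z⟫_ℂ • x.1)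
  rw [T.inner_map_map, map_smul]

lemma covariance_eq_zero {G : Type*} [Group G] [IsProbabilityMeasure ν]
    (π : G →* (H ≃ₗᵢ[ℂ] H))
    (hnofd : ∀ V : Submodule ℂ H, IsClosed (V : Set H) → FiniteDimensional ℂ V →
        (∀ g : G, ∀ x ∈ V, π g x ∈ V) → V = ⊥)
    (hinv : ∀ g : G, Measure.map (ballMap (π g)) ν = ν) : covariance ν = 0 := by
  have hcompact := isCompactOperator_covariance ν
  refine (ContinuousLinearMap.eq_zero_of_forall_hasEigenvalue_eq_zero hcompact
    (isSymmetric_covariance ν)).1 ?_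
  intro μ hμ
  by_contra hμ0
  have hfd := ContinuousLinearMap.finite_dimensional_eigenspace hcompact μ hμ0
  refine hμ (hnofd _ (Submodule.closed_of_finiteDimensional _) hfd fun g x hx => ?_)
  rw [Module.End.mem_eigenspace_iff] at hx ⊢
  change covariance ν x = μ • x at hx
  change covariance ν (π g x) = μ • π g x
  rw [covariance_comm ν (π g) (hinv g), hx, map_smul]

end Covariance

end WeakUnitBall

/-- if a unitary representation `π` of a countable group `G` on a separable
complex Hilbert space has no nonzero finite-dimensional closed invariant subspace, then any
`G`-invariant Borel probability measure on the weakly-topologized closed unit ball is the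
Dirac measure at `0`; equivalently `∫ |⟨y, x⟩|² dν(x) = 0` for every `y`. -/
theorem invariant_measure_on_ball_is_dirac {G : Type*} [Group G] [Countable G]
    (H : Type*) [NormedAddCommGroup H] [InnerProductSpace ℂ H] [CompleteSpace H]
    [TopologicalSpace.SeparableSpace H]
    (π : G →* (H ≃ₗᵢ[ℂ] H))
    (hnofd : ∀ V : Submodule ℂ H, IsClosed (V : Set H) → FiniteDimensional ℂ V →
        (∀ g : G, ∀ x ∈ V, π g x ∈ V) → V = ⊥)
    (ν : Measure (WeakUnitBall H)) [IsProbabilityMeasure ν]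
    (hinv : ∀ g : G, Measure.map (ballMap (π g)) ν = ν) :
    ν = Measure.dirac (zeroBall H) ∧
      ∀ y : H, ∫ x : WeakUnitBall H, ‖⟪y, x.1⟫_ℂ‖ ^ 2 ∂ν = 0 := by
  have hzero : ∀ y : H, ∫ x : WeakUnitBall H, ‖⟪y, x.1⟫_ℂ‖ ^ 2 ∂ν = 0 := fun y => by
    have h := WeakUnitBall.inner_covariance_self ν y
    rw [WeakUnitBall.covariance_eq_zero ν π hnofd hinv] at h
    simpa using h.symm
  refine ⟨?_, hzero⟩
  simpa using (ProbabilityTheory.hasLaw_dirac_of_ae_eq (X := id)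
    (WeakUnitBall.ae_eq_zeroBall ν hzero)).map_eq
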